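/- Let I' ⊂ S = ℂ[x_0,...,x_n] be a homogeneous ideal such that S/I' is a graded Artinian Gorenstein algebra of socle degree s', and let I ⊇ I' be a homogeneous ideal such that S/I is a graded Artinian Gorenstein algebra of socle degree s ≤ s'. Then there exists a homogeneous form h of degree s' - s such that I = (I' : h). -/

import Mathlib

open MvPolynomial

/-- The Hilbert function of the graded quotient `ℂ[x_0,...,x_{n-1}]/I`:
the dimension of the image of the degree-`k` homogeneous forms in the quotient. -/
noncomputable def hilb (n : ℕ) (I : Ideal (MvPolynomial (Fin n) ℂ)) (k : ℕ) : ℕ :=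
  Module.finrank ℂ ((homogeneousSubmodule (Fin n) ℂ k).map
    (Ideal.Quotient.mkₐ ℂ I).toLinearMap)

/-- The socle of `ℂ[x_0,...,x_{n-1}]/I`: the elements annihilated by every
variable (equivalently, by the irrelevant maximal ideal). -/
noncomputable def socle (n : ℕ) (I : Ideal (MvPolynomial (Fin n) ℂ)) :
    Submodule ℂ (MvPolynomial (Fin n) ℂ ⧸ I) :=
  ⨅ i : Fin n, LinearMap.ker (LinearMap.mulLeft ℂ (Ideal.Quotient.mk I (X i)))

/-- `ℂ[x_0,...,x_{n-1}]/I` is a graded Artinian Gorenstein algebra of socle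
degree `s`: `I` is a proper homogeneous ideal, the quotient is
finite-dimensional (Artinian), and the socle is one-dimensional and
concentrated in degree `s`. -/
def IsGradedArtinianGorenstein (n : ℕ) (I : Ideal (MvPolynomial (Fin n) ℂ))
    (s : ℕ) : Prop :=
  (∀ f ∈ I, ∀ k : ℕ, homogeneousComponent k f ∈ I) ∧
  I ≠ ⊤ ∧
  Module.Finite ℂ (MvPolynomial (Fin n) ℂ ⧸ I) ∧
  Module.finrank ℂ (socle n I) = 1 ∧
  socle n I ≤ (homogeneousSubmodule (Fin n) ℂ s).map (Ideal.Quotient.mkₐ ℂ I).toLinearMap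

/-- If the quotient by a homogeneous ideal is finite-dimensional, then the ideal contains a power
of the irrelevant ideal. -/
theorem exists_span_range_X_pow_le {σ K : Type*} [Finite σ] [Field K]
    {I : Ideal (MvPolynomial σ K)}
    (hhom : ∀ f ∈ I, ∀ k : ℕ, homogeneousComponent k f ∈ I)
    [Module.Finite K (MvPolynomial σ K ⧸ I)] :
    ∃ N : ℕ, Ideal.span (Set.range (X : σ → MvPolynomial σ K)) ^ N ≤ I := by
  refine Ideal.exists_pow_le_of_le_radical_of_fg ?_
    ⟨(Set.finite_range (X : σ → MvPolynomial σ K)).toFinset, by simp⟩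
  rw [Ideal.span_le]
  rintro _ ⟨i, rfl⟩
  obtain ⟨p, hp, hp0⟩ := Algebra.IsIntegral.isIntegral (R := K) (Ideal.Quotient.mkₐ K I (X i))
  rw [← Polynomial.aeval_def, Polynomial.aeval_algHom_apply, Ideal.Quotient.mkₐ_eq_mk,
    Ideal.Quotient.eq_zero_iff_mem] at hp0
  refine ⟨p.natDegree, ?_⟩
  have key := hhom _ hp0 p.natDegree
  rwa [Polynomial.aeval_eq_sum_range, map_sum, Finset.sum_eq_single p.natDegree,
    map_smul, homogeneousComponent_of_mem (isHomogeneous_X_pow i p.natDegree), if_pos rfl,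
    Polynomial.coeff_natDegree, hp.leadingCoeff, one_smul] at key
  · intro k _ hk
    rw [map_smul, homogeneousComponent_of_mem (isHomogeneous_X_pow i k), if_neg hk.symm, smul_zero]
  · simp

/-- Every element outside a homogeneous ideal of finite colength has a multiple that
represents a nonzero element of the socle. -/
theorem exists_mul_mem_socle {n : ℕ} {I : Ideal (MvPolynomial (Fin n) ℂ)}
    (hhom : ∀ f ∈ I, ∀ k : ℕ, homogeneousComponent k f ∈ I)
    [Module.Finite ℂ (MvPolynomial (Fin n) ℂ ⧸ I)]
    {f : MvPolynomial (Fin n) ℂ} (hf : f ∉ I) :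
    ∃ g, f * g ∉ I ∧ Ideal.Quotient.mk I (f * g) ∈ socle n I := by
  classical
  set m := Ideal.span (Set.range (X : Fin n → MvPolynomial (Fin n) ℂ))
  have hex : ∃ N : ℕ, ∀ g ∈ m ^ N, f * g ∈ I :=
    (exists_span_range_X_pow_le hhom).imp fun N hN g hg => I.mul_mem_left _ (hN hg)
  obtain ⟨k, hk⟩ : ∃ k, Nat.find hex = k + 1 := by
    refine Nat.exists_eq_succ_of_ne_zero fun h0 => hf ?_
    have := Nat.find_spec hex
    rw [h0] at this
    simpa using this 1 (by simp)
  have hmin := Nat.find_min hex (m := k) (by omega)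
  have hspec := Nat.find_spec hex
  rw [hk] at hspec
  push Not at hmin
  obtain ⟨g, hg, hfg⟩ := hmin
  refine ⟨g, hfg, ?_⟩
  simp only [socle, Submodule.mem_iInf, LinearMap.mem_ker, LinearMap.mulLeft_apply]
  intro i
  rw [← map_mul, Ideal.Quotient.eq_zero_iff_mem, mul_left_comm, mul_comm (X i)]
  exact hspec _ (pow_succ m k ▸ Ideal.mul_mem_mul hg (Ideal.subset_span ⟨i, rfl⟩))

/-- A graded Artinian Gorenstein ideal of socle degree `s` is the annihilator of a linear
functional concentrated in degree `s`. -/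
theorem IsGradedArtinianGorenstein.exists_dual_generator {n s : ℕ}
    {I : Ideal (MvPolynomial (Fin n) ℂ)} (hI : IsGradedArtinianGorenstein n I s) :
    ∃ φ : MvPolynomial (Fin n) ℂ →ₗ[ℂ] ℂ,
      (∀ f, f ∈ I ↔ ∀ g, φ (f * g) = 0) ∧ ∀ f, φ (homogeneousComponent s f) = φ f := by
  obtain ⟨hhom, -, hfin, hrank, hdeg⟩ := hI
  obtain ⟨⟨v, hv⟩, hv0, hspan⟩ := finrank_eq_one_iff'.mp hrank
  have hv0 : v ≠ 0 := fun h => hv0 (Subtype.ext h)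
  obtain ⟨l, hl⟩ := Module.Projective.exists_dual_ne_zero ℂ hv0
  let φ : MvPolynomial (Fin n) ℂ →ₗ[ℂ] ℂ :=
    l ∘ₗ (Ideal.Quotient.mkₐ ℂ I).toLinearMap ∘ₗ homogeneousComponent s
  have hφ (f) : φ f = l (Ideal.Quotient.mk I (homogeneousComponent s f)) := rfl
  refine ⟨φ, fun f => ⟨fun hf g => ?_, fun h => ?_⟩, fun f => ?_⟩
  · rw [hφ, Ideal.Quotient.eq_zero_iff_mem.mpr (hhom _ (I.mul_mem_right g hf) s), map_zero]
  · by_contra hf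
    obtain ⟨g, hfg, hsoc⟩ := exists_mul_mem_socle hhom hf
    obtain ⟨u, hu, hu_eq⟩ := hdeg hsoc
    obtain ⟨c, hc⟩ := hspan ⟨_, hsoc⟩
    replace hc : c • v = Ideal.Quotient.mk I (f * g) := congrArg Subtype.val hc
    have hsub : f * g - u ∈ I := Ideal.Quotient.eq.mp hu_eq.symm
    have hcomp := hhom _ hsub s
    rw [map_sub, homogeneousComponent_of_mem hu, if_pos rfl] at hcomp
    have hval := h g
    rw [hφ, Ideal.Quotient.eq.mpr hcomp] at hval
    change Ideal.Quotient.mk I u = _ at hu_eq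
    rw [hu_eq, ← hc, map_smul, smul_eq_mul, mul_eq_zero, or_iff_left hl] at hval
    rw [hval, zero_smul] at hc
    exact hfg (Ideal.Quotient.eq_zero_iff_mem.mp hc.symm)
  · rw [hφ, hφ, homogeneousComponent_of_mem (homogeneousComponent_mem s f), if_pos rfl]

/-- A functional vanishing on an ideal `I` of finite colength is a multiple of any functional
whose annihilator is `I`. -/
theorem exists_eq_apply_mul {K A : Type*} [Field K] [CommRing A] [Algebra K A]
    {I : Ideal A} [Module.Finite K (A ⧸ I)] {φ ψ : A →ₗ[K] K}
    (hφ : ∀ f, f ∈ I ↔ ∀ g, φ (f * g) = 0) (hψ : ∀ f ∈ I, ψ f = 0) :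
    ∃ h, ∀ f, ψ f = φ (h * f) := by
  have hφI : I.restrictScalars K ≤ LinearMap.ker φ := fun f hf => by
    simpa using (hφ f).mp hf 1
  let φ' : (A ⧸ I) →ₗ[K] K := (I.restrictScalars K).liftQ φ hφI
  let ψ' : (A ⧸ I) →ₗ[K] K := (I.restrictScalars K).liftQ ψ hψ
  let Θ : (A ⧸ I) →ₗ[K] Module.Dual K (A ⧸ I) := (LinearMap.mul K (A ⧸ I)).compr₂ φ'
  have hΘ : Function.Injective Θ := by
    rw [injective_iff_map_eq_zero]
    intro a ha
    obtain ⟨f, rfl⟩ := Ideal.Quotient.mk_surjective a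
    rw [Ideal.Quotient.eq_zero_iff_mem, hφ]
    exact fun g => LinearMap.congr_fun ha (Ideal.Quotient.mk I g)
  obtain ⟨a, ha⟩ := (LinearMap.injective_iff_surjective_of_finrank_eq_finrank
    Subspace.dual_finrank_eq.symm).mp hΘ ψ'
  obtain ⟨h, rfl⟩ := Ideal.Quotient.mk_surjective a
  exact ⟨h, fun f => (LinearMap.congr_fun ha (Ideal.Quotient.mk I f)).symm⟩

theorem MvPolynomial.IsHomogeneous.homogeneousComponent_mul_right {σ R : Type*} [CommSemiring R]
    {q : MvPolynomial σ R} {e : ℕ} (hq : q.IsHomogeneous e) (p : MvPolynomial σ R) (d : ℕ) :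
    homogeneousComponent (d + e) (p * q) = homogeneousComponent d p * q := by
  let _ : GradedAlgebra (homogeneousSubmodule σ R) := gradedAlgebra
  simp only [← decomposition.decompose'_apply]
  exact DirectSum.coe_decompose_mul_add_of_right_mem (homogeneousSubmodule σ R) hq

theorem MvPolynomial.homogeneousComponent_homogeneousComponent_mul {σ R : Type*} [CommSemiring R]
    (p f : MvPolynomial σ R) (d e : ℕ) :
    homogeneousComponent (d + e) (homogeneousComponent d p * f) =
      homogeneousComponent (d + e) (p * homogeneousComponent e f) := by
  rw [(homogeneousComponent_isHomogeneous e f).homogeneousComponent_mul_right, mul_comm, add_comm,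
    (homogeneousComponent_isHomogeneous d p).homogeneousComponent_mul_right, mul_comm]

/-- A graded Artinian Gorenstein quotient of a graded Artinian Gorenstein
algebra is a link: if `I' ⊆ I` with socle degrees `s' ≥ s`, then there is a
homogeneous form `h` of degree `s' - s` with `I = (I' : h)`. -/
theorem gorenstein_quotient_is_link (n : ℕ)
    (I' I : Ideal (MvPolynomial (Fin n) ℂ)) (s' s : ℕ)
    (hgor' : IsGradedArtinianGorenstein n I' s')
    (hgor : IsGradedArtinianGorenstein n I s)
    (hle : I' ≤ I) (hs : s ≤ s') :
    ∃ h : MvPolynomial (Fin n) ℂ, h.IsHomogeneous (s' - s) ∧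
      I = Submodule.colon I' (Ideal.span {h}) := by
  have := hgor'.2.2.1
  obtain ⟨φ', hφ', hdeg'⟩ := hgor'.exists_dual_generator
  obtain ⟨φ, hφ, hdeg⟩ := hgor.exists_dual_generator
  obtain ⟨p, hp⟩ := exists_eq_apply_mul (ψ := φ) hφ' fun f hf => by
    simpa using (hφ f).mp (hle hf) 1
  have hmul (f) : φ f = φ' (homogeneousComponent (s' - s) p * f) := by
    rw [← hdeg f, hp, ← hdeg', ← hdeg' (_ * f)]
    have := homogeneousComponent_homogeneousComponent_mul p f (s' - s) s
    rw [Nat.sub_add_cancel hs] at this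
    rw [this]
  refine ⟨_, homogeneousComponent_isHomogeneous (s' - s) p, ?_⟩
  ext f
  rw [Ideal.mem_colon_span_singleton, hφ, hφ']
  refine forall_congr' fun g => ?_
  rw [hmul]
  ring_nf
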